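/- For every ω ∈ ℝ \ {0} and all m, n ∈ ℤ: (1) ∑_{k=−∞}^{∞} φ_k(ω q^{2m}) φ_k(ω q^{2n}) = δ_{m,n} · ω^{−4n} q^{−2n(2n−1)} · 4 ((q²;q²)_∞² / (q;q²)_∞²) θ_{q²}(−ω²), and (2) ∑_{k=−∞}^{∞} φ_k(ω q^{2m}) φ_k(−ω^{−1} q^{2n}) = 0. -/

import Mathlib

open Complex Filter Topology

/-- Finite q-Pochhammer symbol `(a;q)_n`. -/
noncomputable def qp (q a : ℂ) (n : ℕ) : ℂ := ∏ k ∈ Finset.range n, (1 - a * q ^ k)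

/-- Infinite q-Pochhammer symbol `(a;q)_∞`. -/
noncomputable def qpInf (q a : ℂ) : ℂ := ∏' k : ℕ, (1 - a * q ^ k)

/-- Theta function `θ_q(x) = (x;q)_∞ (q/x;q)_∞`. -/
noncomputable def theta (q x : ℂ) : ℂ := qpInf q x * qpInf q (q / x)

/-- The square-summable solution φ_n(x). -/
noncomputable def phi (q : ℝ) (x : ℂ) (n : ℤ) : ℂ :=
  qpInf (q : ℂ) (-1) * x ^ n * (q : ℂ) ^ (n * (n - 1) / 2) *
    ∑' k : ℕ, (q : ℂ) ^ (2 * (k * (k - 1))) *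
      (-((q : ℂ) ^ (-2 * n + 4)) * x ^ (-2 : ℤ)) ^ k /
        qp ((q : ℂ) ^ 2) ((q : ℂ) ^ 2) k

/-- The general term `z ^ l * p ^ (l * (l - 1) / 2)` of a theta series. -/
noncomputable def gauss (p z : ℂ) (l : ℤ) : ℂ := z ^ l * p ^ (l * (l - 1) / 2)

lemma two_mul_triangle (l : ℤ) : 2 * (l * (l - 1) / 2) = l * (l - 1) :=
  Int.mul_ediv_cancel' l.even_mul_pred_self.two_dvd

lemma triangle_add (l N : ℤ) :
    (l + N) * (l + N - 1) / 2 = N * (N - 1) / 2 + N * l + l * (l - 1) / 2 := by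
  have h1 := two_mul_triangle (l + N)
  have h2 := two_mul_triangle l
  have h3 := two_mul_triangle N
  refine mul_left_cancel₀ (two_ne_zero (α := ℤ)) ?_
  linear_combination h1 - h2 - h3

lemma gauss_add {p z : ℂ} (hp : p ≠ 0) (hz : z ≠ 0) (l N : ℤ) :
    gauss p z (l + N) = gauss p z N * gauss p (p ^ N * z) l := by
  simp only [gauss, triangle_add, zpow_add₀ hp, zpow_add₀ hz, zpow_mul, mul_zpow]
  ring

lemma gauss_mul_left (p u z : ℂ) (l : ℤ) : gauss p (u * z) l = u ^ l * gauss p z l := by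
  simp only [gauss, mul_zpow, mul_assoc]

lemma gauss_neg {p z : ℂ} (hp : p ≠ 0) (l : ℤ) :
    gauss p z (-l) = gauss p (p / z) l := by
  have h : -l * (-l - 1) / 2 = l + l * (l - 1) / 2 := by
    have h1 := two_mul_triangle (-l)
    have h2 := two_mul_triangle l
    refine mul_left_cancel₀ (two_ne_zero (α := ℤ)) ?_
    linear_combination h1 - h2
  simp only [gauss, h, zpow_add₀ hp, div_zpow, zpow_neg]
  ring

lemma gauss_natCast_succ (p z : ℂ) (n : ℕ) :
    gauss p z (n + 1 : ℕ) = gauss p z n * (z * p ^ n) := by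
  have h : ((n + 1 : ℕ) : ℤ) * ((n + 1 : ℕ) - 1) / 2 = (n * (n - 1) / 2 : ℤ) + n := by
    push_cast
    rw [triangle_add]
    simp
    ring
  have h0 : (n * (n - 1) / 2 : ℤ) = ((n * (n - 1) / 2 : ℕ) : ℤ) := by
    cases n <;> simp
  rw [gauss, gauss, h, h0]
  norm_cast
  ring

lemma summable_norm_gauss_nat {p z : ℂ} (hp : p ≠ 0) (hp1 : ‖p‖ < 1) (hz : z ≠ 0) :
    Summable fun n : ℕ => ‖gauss p z n‖ := by
  have hne (n : ℕ) : gauss p z n ≠ 0 := mul_ne_zero (zpow_ne_zero _ hz) (zpow_ne_zero _ hp)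
  refine summable_of_ratio_test_tendsto_lt_one (l := 0) one_pos
    (Eventually.of_forall fun n => norm_ne_zero_iff.2 (hne n)) ?_
  have h : Tendsto (fun n : ℕ => ‖z‖ * ‖p‖ ^ n) atTop (𝓝 (‖z‖ * 0)) :=
    (tendsto_pow_atTop_nhds_zero_of_lt_one (norm_nonneg p) hp1).const_mul _
  rw [mul_zero] at h
  refine h.congr fun n => ?_
  rw [gauss_natCast_succ, norm_norm, norm_norm, norm_mul,
    mul_div_cancel_left₀ _ (norm_ne_zero_iff.2 (hne n)),
    norm_mul, norm_pow]

lemma summable_norm_gauss {p z : ℂ} (hp : p ≠ 0) (hp1 : ‖p‖ < 1) (hz : z ≠ 0) :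
    Summable fun l : ℤ => ‖gauss p z l‖ := by
  refine Summable.of_nat_of_neg (summable_norm_gauss_nat hp hp1 hz) ?_
  simp only [gauss_neg hp]
  exact summable_norm_gauss_nat hp hp1 (div_ne_zero hp hz)

lemma exists_norm_gauss_le {p z : ℂ} (hp : p ≠ 0) (hp1 : ‖p‖ < 1) (hz : z ≠ 0) :
    ∃ M, ∀ l, ‖gauss p z l‖ ≤ M :=
  ⟨_, fun l => (summable_norm_gauss hp hp1 hz).le_tsum l fun _ _ => norm_nonneg _⟩

lemma summable_norm_mul_geometric (a : ℂ) {p : ℂ} (hp1 : ‖p‖ < 1) :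
    Summable fun k : ℕ => ‖-(a * p ^ k)‖ := by
  simp only [norm_neg, norm_mul, norm_pow]
  exact (summable_geometric_of_lt_one (norm_nonneg p) hp1).mul_left _

lemma multipliable_qpInf (a : ℂ) {p : ℂ} (hp1 : ‖p‖ < 1) :
    Multipliable fun k : ℕ => 1 - a * p ^ k := by
  simpa only [sub_eq_add_neg] using
    multipliable_one_add_of_summable (summable_norm_mul_geometric a hp1)

lemma tendsto_qp (a : ℂ) {p : ℂ} (hp1 : ‖p‖ < 1) :
    Tendsto (qp p a) atTop (𝓝 (qpInf p a)) :=
  (multipliable_qpInf a hp1).hasProd.tendsto_prod_nat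

lemma one_sub_pow_succ_ne_zero {p : ℂ} (hp1 : ‖p‖ < 1) (k : ℕ) : 1 - p ^ (k + 1) ≠ 0 := by
  intro h
  have h1 : ‖p ^ (k + 1)‖ < 1 := by
    rw [norm_pow]
    exact pow_lt_one₀ (norm_nonneg p) hp1 k.succ_ne_zero
  rw [← sub_eq_zero.1 h, norm_one] at h1
  exact h1.false

lemma qpInf_self_ne_zero {p : ℂ} (hp1 : ‖p‖ < 1) : qpInf p p ≠ 0 := by
  have h := tprod_one_add_ne_zero_of_summable (f := fun k : ℕ => -(p * p ^ k))
    (fun k => by simpa only [← sub_eq_add_neg, ← pow_succ'] using one_sub_pow_succ_ne_zero hp1 k)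
    (summable_norm_mul_geometric p hp1)
  simpa only [qpInf, sub_eq_add_neg] using h

lemma qp_succ (p a : ℂ) (n : ℕ) : qp p a (n + 1) = qp p a n * (1 - a * p ^ n) :=
  Finset.prod_range_succ _ _

lemma qp_zero (p a : ℂ) : qp p a 0 = 1 := Finset.prod_range_zero _

lemma qp_self_ne_zero {p : ℂ} (hp1 : ‖p‖ < 1) (n : ℕ) : qp p p n ≠ 0 :=
  Finset.prod_ne_zero_iff.2 fun k _ => by
    simpa only [← pow_succ'] using one_sub_pow_succ_ne_zero hp1 k

lemma exists_norm_inv_qp_le {p : ℂ} (hp1 : ‖p‖ < 1) : ∃ M, ∀ n, ‖(qp p p n)⁻¹‖ ≤ M := by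
  obtain ⟨M, hM⟩ := ((tendsto_qp p hp1).inv₀ (qpInf_self_ne_zero hp1)).norm.bddAbove_range
  exact ⟨M, fun n => hM ⟨n, rfl⟩⟩

lemma qpInf_eq_qp_mul (a : ℂ) {p : ℂ} (hp1 : ‖p‖ < 1) (n : ℕ) :
    qpInf p a = qp p a n * qpInf p (p ^ n * a) := by
  have h2 : Tendsto (fun k => qp p a n * qp p (p ^ n * a) k) atTop
      (𝓝 (qp p a n * qpInf p (p ^ n * a))) := (tendsto_qp _ hp1).const_mul _
  have h1 := (tendsto_qp a hp1).comp (tendsto_add_atTop_nat n)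
  refine tendsto_nhds_unique h1 (h2.congr fun k => ?_)
  simp only [Function.comp, qp]
  rw [add_comm k n, Finset.prod_range_add]
  congr 1
  exact Finset.prod_congr rfl fun i _ => by ring

/-- `(p⁻ᴺ;p)_∞ = 0` for `N ≥ 0`. -/
lemma qpInf_zpow_eq_zero {p : ℂ} (hp : p ≠ 0) (hp1 : ‖p‖ < 1) {N : ℤ} (hN : N ≤ 0) :
    qpInf p (p ^ N) = 0 := by
  obtain ⟨k, rfl⟩ : ∃ k : ℕ, N = -k := ⟨N.natAbs, by omega⟩
  rw [qpInf_eq_qp_mul _ hp1 (k + 1), qp_succ]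
  simp [hp]

/-- A power series is continuous at the origin along a geometric sequence. -/
lemma tendsto_tsum_mul_pow {c : ℕ → ℂ} {p z : ℂ} (hp1 : ‖p‖ < 1)
    (hc : Summable fun b => ‖c b * z ^ b‖) :
    Tendsto (fun n : ℕ => ∑' b, c b * (p ^ n * z) ^ b) atTop (𝓝 (c 0)) := by
  have h0 : c 0 = ∑' b, c b * (0 : ℂ) ^ b := by
    rw [tsum_eq_single 0 fun b hb => by simp [hb]]
    simp
  rw [h0]
  refine tendsto_tsum_of_dominated_convergence hc (fun b => ?_) (Eventually.of_forall fun n b => ?_)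
  · have h : Tendsto (fun n : ℕ => p ^ n * z) atTop (𝓝 (0 * z)) :=
      (tendsto_pow_atTop_nhds_zero_of_norm_lt_one hp1).mul_const z
    rw [zero_mul] at h
    exact (h.pow b).const_mul _
  · rw [mul_pow, norm_mul, norm_mul, norm_mul, norm_pow, norm_pow]
    refine mul_le_mul_of_nonneg_left ?_ (norm_nonneg _)
    exact mul_le_of_le_one_left (norm_nonneg _)
      (pow_le_one₀ (pow_nonneg (norm_nonneg _) _) (pow_le_one₀ (norm_nonneg _) hp1.le))

lemma tsum_mul_pow_sub {c : ℕ → ℂ} {p z : ℂ} (hp1 : ‖p‖ < 1)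
    (hc : Summable fun b => ‖c b * z ^ b‖) :
    ∑' b, c b * z ^ b - ∑' b, c b * (p * z) ^ b =
      ∑' b, c (b + 1) * (1 - p ^ (b + 1)) * z ^ (b + 1) := by
  have hc' : Summable fun b => c b * (p * z) ^ b := by
    refine Summable.of_norm_bounded hc fun b => ?_
    rw [mul_pow, norm_mul, norm_mul, norm_mul, norm_pow]
    refine mul_le_mul_of_nonneg_left ?_ (norm_nonneg _)
    exact mul_le_of_le_one_left (norm_nonneg _) (pow_le_one₀ (norm_nonneg _) hp1.le)
  have h : ∀ b, c b * z ^ b - c b * (p * z) ^ b = c b * (1 - p ^ b) * z ^ b :=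
    fun b => by ring
  rw [← hc.of_norm.tsum_sub hc']
  simp only [h]
  have hs : Summable fun b => c b * (1 - p ^ b) * z ^ b := by
    simpa only [h] using hc.of_norm.sub hc'
  rw [hs.tsum_eq_zero_add]
  simp

lemma summable_norm_euler {p : ℂ} (z : ℂ) (hp : p ≠ 0) (hp1 : ‖p‖ < 1) :
    Summable fun b : ℕ => ‖gauss p (-1) b / qp p p b * z ^ b‖ := by
  rcases eq_or_ne z 0 with rfl | hz
  · refine summable_of_ne_finset_zero (s := {0}) fun b hb => ?_
    simp [Finset.notMem_singleton.1 hb]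
  obtain ⟨M, hM⟩ := exists_norm_inv_qp_le hp1
  refine Summable.of_nonneg_of_le (fun _ => norm_nonneg _) (fun b => ?_)
    ((summable_norm_gauss_nat hp hp1 hz).mul_left M)
  rw [div_eq_mul_inv, mul_right_comm, mul_comm, norm_mul]
  refine mul_le_mul (hM b) (le_of_eq ?_) (norm_nonneg _) ((norm_nonneg _).trans (hM b))
  simp [gauss, mul_comm]

/-- Euler's expansion of `(z;p)_∞`. -/
lemma qpInf_eq_tsum {p : ℂ} (z : ℂ) (hp : p ≠ 0) (hp1 : ‖p‖ < 1) :
    qpInf p z = ∑' b : ℕ, gauss p (-1) b / qp p p b * z ^ b := by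
  have hstep (w : ℂ) : ∑' b : ℕ, gauss p (-1) b / qp p p b * w ^ b =
      (1 - w) * ∑' b : ℕ, gauss p (-1) b / qp p p b * (p * w) ^ b := by
    have h := tsum_mul_pow_sub hp1 (summable_norm_euler w hp hp1)
    have h2 : ∀ b : ℕ, gauss p (-1) (b + 1 : ℕ) / qp p p (b + 1) * (1 - p ^ (b + 1)) * w ^ (b + 1)
        = -w * (gauss p (-1) b / qp p p b * (p * w) ^ b) := fun b => by
      have h3 := qp_self_ne_zero hp1 b
      have h4 := one_sub_pow_succ_ne_zero hp1 b
      rw [gauss_natCast_succ, qp_succ, ← pow_succ']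
      field_simp
      ring
    simp only [h2, tsum_mul_left] at h
    linear_combination h
  have hiter (n : ℕ) : ∑' b : ℕ, gauss p (-1) b / qp p p b * z ^ b =
      qp p z n * ∑' b : ℕ, gauss p (-1) b / qp p p b * (p ^ n * z) ^ b := by
    induction n with
    | zero => simp [qp_zero]
    | succ n ih =>
      rw [ih, hstep, qp_succ, pow_succ' p n]
      ring_nf
  have h := (tendsto_qp z hp1).mul (tendsto_tsum_mul_pow hp1 (summable_norm_euler z hp hp1))
  simp only [← hiter] at h
  have h2 := tendsto_nhds_unique tendsto_const_nhds h
  rw [h2]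
  simp [gauss, qp_zero]

lemma summable_norm_pow_div_qp {p u : ℂ} (hp1 : ‖p‖ < 1) (hu : ‖u‖ < 1) :
    Summable fun b : ℕ => ‖(qp p p b)⁻¹ * u ^ b‖ := by
  obtain ⟨M, hM⟩ := exists_norm_inv_qp_le hp1
  refine Summable.of_nonneg_of_le (fun _ => norm_nonneg _) (fun b => ?_)
    ((summable_geometric_of_lt_one (norm_nonneg u) hu).mul_left M)
  rw [norm_mul, norm_pow]
  exact mul_le_mul_of_nonneg_right (hM b) (by positivity)

/-- Euler's expansion of `1 / (u;p)_∞`. -/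
lemma tsum_pow_div_qp_mul_qpInf {p u : ℂ} (hp1 : ‖p‖ < 1) (hu : ‖u‖ < 1) :
    (∑' b : ℕ, (qp p p b)⁻¹ * u ^ b) * qpInf p u = 1 := by
  have hun (n : ℕ) : ‖p ^ n * u‖ < 1 := by
    rw [norm_mul, norm_pow]
    exact (mul_le_of_le_one_left (norm_nonneg _) (pow_le_one₀ (norm_nonneg _) hp1.le)).trans_lt hu
  have hstep (w : ℂ) (hw : ‖w‖ < 1) : ∑' b : ℕ, (qp p p b)⁻¹ * (p * w) ^ b =
      (1 - w) * ∑' b : ℕ, (qp p p b)⁻¹ * w ^ b := by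
    have h := tsum_mul_pow_sub hp1 (summable_norm_pow_div_qp hp1 hw)
    have h2 : ∀ b : ℕ, (qp p p (b + 1))⁻¹ * (1 - p ^ (b + 1)) * w ^ (b + 1)
        = w * ((qp p p b)⁻¹ * w ^ b) := fun b => by
      have h3 := qp_self_ne_zero hp1 b
      have h4 := one_sub_pow_succ_ne_zero hp1 b
      rw [qp_succ, ← pow_succ']
      field_simp
      ring
    simp only [h2, tsum_mul_left] at h
    linear_combination -h
  have hiter (n : ℕ) : ∑' b : ℕ, (qp p p b)⁻¹ * (p ^ n * u) ^ b =
      qp p u n * ∑' b : ℕ, (qp p p b)⁻¹ * u ^ b := by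
    induction n with
    | zero => simp [qp_zero]
    | succ n ih =>
      rw [pow_succ', mul_assoc, hstep _ (hun n), ih, qp_succ]
      ring
  have h := tendsto_tsum_mul_pow hp1 (summable_norm_pow_div_qp hp1 hu)
  simp only [hiter] at h
  have h2 := tendsto_nhds_unique h ((tendsto_qp u hp1).mul_const _)
  rw [mul_comm, ← h2]
  simp [qp_zero]

lemma gauss_ne_zero {p z : ℂ} (hp : p ≠ 0) (hz : z ≠ 0) (l : ℤ) : gauss p z l ≠ 0 :=
  mul_ne_zero (zpow_ne_zero _ hz) (zpow_ne_zero _ hp)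

lemma tsum_gauss_mul_qpInf {p : ℂ} (z : ℂ) (hp : p ≠ 0) (hp1 : ‖p‖ < 1) :
    ∑' l : ℤ, gauss p (-z) l * qpInf p (p ^ (l + 1)) = qpInf p p * qpInf p z := by
  rw [← Nat.cast_injective.tsum_eq (f := fun l : ℤ => gauss p (-z) l * qpInf p (p ^ (l + 1))),
    qpInf_eq_tsum z hp hp1, ← tsum_mul_left]
  · refine tsum_congr fun b => ?_
    rw [qpInf_eq_qp_mul p hp1 b, ← pow_succ, ← mul_neg_one z, gauss_mul_left, zpow_natCast]
    have h := qp_self_ne_zero hp1 b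
    norm_cast
    field_simp
  · intro l hl
    by_contra hneg
    refine hl ?_
    have hl0 : l + 1 ≤ 0 := by
      by_contra! h
      exact hneg ⟨l.toNat, by omega⟩
    simp only [qpInf_zpow_eq_zero hp hp1 hl0, mul_zero]

/-- The shear `(l, b) ↦ (l + b, b)`. -/
def shear : ℤ × ℕ ≃ ℤ × ℕ where
  toFun x := (x.1 + x.2, x.2)
  invFun x := (x.1 - x.2, x.2)
  left_inv x := by simp
  right_inv x := by simp

/-- The shear `(n, a, b) ↦ ((a, b), n - a - b)`. -/
def pairShear : ℤ × (ℕ × ℕ) ≃ (ℕ × ℕ) × ℤ where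
  toFun t := (t.2, t.1 - t.2.1 - t.2.2)
  invFun t := (t.2 + t.1.2 + t.1.1, t.1)
  left_inv t := by simp
  right_inv t := by simp

/-- The Jacobi triple product in the region where Euler's expansion of `1 / (p / z;p)_∞`
converges. -/
lemma jacobi_triple_product_of_norm_lt {p z : ℂ} (hp : p ≠ 0) (hp1 : ‖p‖ < 1) (hz : ‖p‖ < ‖z‖) :
    qpInf p p * theta p z = ∑' l : ℤ, gauss p (-z) l := by
  have hz0 : z ≠ 0 := norm_pos_iff.1 ((norm_nonneg p).trans_lt hz)
  have hu : ‖p / z‖ < 1 := by rwa [norm_div, div_lt_one (norm_pos_iff.2 hz0)]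
  have hgauss := summable_norm_gauss hp hp1 (neg_ne_zero.2 hz0)
  have hinv := summable_norm_pow_div_qp hp1 hu
  have hterm (l : ℤ) (b : ℕ) : gauss p (-z) (l + b) * ((qp p p b)⁻¹ * (p / z) ^ b) =
      gauss p (-z) l * (gauss p (-1) b / qp p p b * (p ^ (l + 1)) ^ b) := by
    rw [add_comm l, gauss_add hp (neg_ne_zero.2 hz0), ← mul_neg_one z, ← mul_assoc (p ^ l),
      gauss_mul_left p (p ^ l * z), zpow_natCast, zpow_add_one₀ hp]
    simp only [div_pow, mul_pow]
    field_simp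
  have hsummable : Summable fun x : ℤ × ℕ =>
      gauss p (-z) (x.1 + x.2) * ((qp p p x.2)⁻¹ * (p / z) ^ x.2) :=
    shear.summable_iff.2 (summable_mul_of_summable_norm hgauss hinv)
  have hsum : ∑' l : ℤ, gauss p (-z) l * qpInf p (p ^ (l + 1)) =
      (∑' l : ℤ, gauss p (-z) l) * ∑' b : ℕ, (qp p p b)⁻¹ * (p / z) ^ b := by
    rw [tsum_mul_tsum_of_summable_norm hgauss hinv, ← shear.tsum_eq]
    refine Eq.trans ?_ hsummable.tsum_prod.symm
    simp only [hterm, tsum_mul_left, ← qpInf_eq_tsum _ hp hp1]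
  rw [theta, ← mul_assoc, ← tsum_gauss_mul_qpInf z hp hp1, hsum, mul_assoc,
    tsum_pow_div_qp_mul_qpInf hp1 hu, mul_one]

lemma tsum_gauss_zpow_mul {p z : ℂ} (hp : p ≠ 0) (hz : z ≠ 0) (N : ℤ) :
    ∑' l : ℤ, gauss p (p ^ N * z) l = (gauss p z N)⁻¹ * ∑' l : ℤ, gauss p z l := by
  rw [← (Equiv.addRight N).tsum_eq (gauss p z)]
  simp only [Equiv.coe_addRight, gauss_add hp hz, tsum_mul_left]
  rw [inv_mul_cancel_left₀ (gauss_ne_zero hp hz N)]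

lemma qpInf_eq_one_sub_mul (z : ℂ) {p : ℂ} (hp1 : ‖p‖ < 1) :
    qpInf p z = (1 - z) * qpInf p (p * z) := by
  simpa [qp_succ, qp_zero] using qpInf_eq_qp_mul z hp1 1

lemma theta_mul_self {p z : ℂ} (hp : p ≠ 0) (hp1 : ‖p‖ < 1) (hz : z ≠ 0) :
    theta p (p * z) = (-z)⁻¹ * theta p z := by
  have h1 := qpInf_eq_one_sub_mul z hp1
  have h2 := qpInf_eq_one_sub_mul z⁻¹ hp1
  have h3 : p / (p * z) = z⁻¹ := by field_simp
  rw [theta, theta, h3, h1, h2, div_eq_mul_inv p z]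
  field_simp
  ring

/-- The Jacobi triple product. -/
lemma jacobi_triple_product {p z : ℂ} (hp : p ≠ 0) (hp1 : ‖p‖ < 1) (hz : z ≠ 0) :
    qpInf p p * theta p z = ∑' l : ℤ, gauss p (-z) l := by
  have hshift (w : ℂ) (hw : w ≠ 0) (h : qpInf p p * theta p w = ∑' l : ℤ, gauss p (-w) l) :
      qpInf p p * theta p (p * w) = ∑' l : ℤ, gauss p (-(p * w)) l := by
    have h2 := tsum_gauss_zpow_mul hp (neg_ne_zero.2 hw) 1
    rw [zpow_one, mul_neg, ← h] at h2
    rw [h2, theta_mul_self hp hp1 hw]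
    simp [gauss]
    ring
  have hiter (n : ℕ) (w : ℂ) (hw : w ≠ 0)
      (h : qpInf p p * theta p w = ∑' l : ℤ, gauss p (-w) l) :
      qpInf p p * theta p (p ^ n * w) = ∑' l : ℤ, gauss p (-(p ^ n * w)) l := by
    induction n with
    | zero => simpa using h
    | succ n ih =>
      rw [pow_succ', mul_assoc]
      exact hshift _ (mul_ne_zero (pow_ne_zero _ hp) hw) ih
  obtain ⟨n, hn⟩ := exists_pow_lt_of_lt_one (norm_pos_iff.2 hz) hp1
  have hpn := pow_ne_zero n hp
  have h := hiter n (z / p ^ n) (div_ne_zero hz hpn) <|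
    jacobi_triple_product_of_norm_lt hp hp1 <| by
      rw [norm_div, norm_pow]
      refine hp1.trans ((one_lt_div (pow_pos (norm_pos_iff.2 hp) n)).2 hn)
  rwa [mul_div_cancel₀ _ hpn] at h

lemma tsum_gauss_neg_zpow {p : ℂ} (hp : p ≠ 0) (hp1 : ‖p‖ < 1) (N : ℤ) :
    ∑' l : ℤ, gauss p (-p ^ N) l = 0 := by
  rw [← jacobi_triple_product hp hp1 (zpow_ne_zero N hp), theta]
  rcases le_or_gt N 0 with hN | hN
  · rw [qpInf_zpow_eq_zero hp hp1 hN]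
    ring
  · have h : p / p ^ N = p ^ (1 - N) := by rw [zpow_sub₀ hp, zpow_one]
    rw [h, qpInf_zpow_eq_zero hp hp1 (N := 1 - N) (by omega)]
    ring

lemma norm_sq_lt_one {q : ℂ} (hq1 : ‖q‖ < 1) : ‖q ^ 2‖ < 1 := by
  rw [norm_pow]
  exact pow_lt_one₀ (norm_nonneg q) hq1 two_ne_zero

/-- Euler's identity `(-q;q)_∞ (q;q²)_∞ = 1`. -/
lemma qpInf_neg_one_mul {q : ℂ} (hq1 : ‖q‖ < 1) :
    qpInf q (-1) * qpInf (q ^ 2) q = 2 := by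
  have hp1 := norm_sq_lt_one hq1
  have hsq : qpInf q (-q) * qpInf q q = qpInf (q ^ 2) (q ^ 2) := by
    rw [qpInf, qpInf, ← (multipliable_qpInf (-q) hq1).tprod_mul (multipliable_qpInf q hq1), qpInf]
    exact tprod_congr fun k => by ring
  have hsplit : qpInf (q ^ 2) q * qpInf (q ^ 2) (q ^ 2) = qpInf q q := by
    have h := tprod_even_mul_odd (f := fun k => 1 - q * q ^ k)
      ((multipliable_qpInf q hp1).congr fun k => by ring)
      ((multipliable_qpInf (q ^ 2) hp1).congr fun k => by ring)
    rw [qpInf, qpInf, qpInf, ← h]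
    congr 1 <;> exact tprod_congr fun k => by ring
  have h := qpInf_eq_one_sub_mul (-1) hq1
  rw [mul_neg_one] at h
  refine mul_right_cancel₀ (qpInf_self_ne_zero hp1) ?_
  rw [mul_assoc, hsplit, h, ← hsq]
  ring

lemma gauss_sq {q : ℂ} (z : ℂ) (l : ℤ) : gauss (q ^ 2) z l = z ^ l * q ^ (l * (l - 1)) := by
  rw [gauss, ← zpow_natCast q 2, ← zpow_mul, Nat.cast_two, two_mul_triangle]

lemma gauss_add_mul_gauss_sub {q x y : ℂ} (hq : q ≠ 0) (hx : x ≠ 0) (hy : y ≠ 0) (l d : ℤ) :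
    gauss q x (l + d) * gauss q y (l - d) =
      gauss (q ^ 2) (x * y) l * gauss (q ^ 2) (q * (x / y)) d := by
  have h : (l + d) * (l + d - 1) / 2 + (l - d) * (l - d - 1) / 2 =
      l * (l - 1) + (d + d * (d - 1)) := by
    have h1 := two_mul_triangle (l + d)
    have h2 := two_mul_triangle (l - d)
    refine mul_left_cancel₀ (two_ne_zero (α := ℤ)) ?_
    linear_combination h1 + h2
  rw [gauss_sq, gauss_sq]
  calc gauss q x (l + d) * gauss q y (l - d)
      = x ^ (l + d) * y ^ (l - d) *
        q ^ ((l + d) * (l + d - 1) / 2 + (l - d) * (l - d - 1) / 2) := by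
        rw [zpow_add₀ hq, gauss, gauss]
        ring
    _ = _ := by
        rw [h, zpow_add₀ hq, zpow_add₀ hq, zpow_add₀ hx, zpow_sub₀ hy]
        simp only [mul_zpow, div_zpow]
        ring

/-- The coefficients of `φ_n` in terms of the functions `gauss q x (n - 2 * k)`. -/
noncomputable def phiCoeff (q : ℂ) (k : ℕ) : ℂ := (qp (q ^ 2) (q ^ 2) k)⁻¹ * (-q) ^ k

lemma summable_norm_phiCoeff {q : ℂ} (hq1 : ‖q‖ < 1) : Summable fun k => ‖phiCoeff q k‖ :=
  summable_norm_pow_div_qp (norm_sq_lt_one hq1) (by rwa [norm_neg])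

lemma summable_norm_phiCoeff_mul_gauss {q x : ℂ} (hq : q ≠ 0) (hq1 : ‖q‖ < 1) (hx : x ≠ 0)
    (n : ℤ) : Summable fun k : ℕ => ‖phiCoeff q k * gauss q x (n - 2 * k)‖ := by
  obtain ⟨M, hM⟩ := exists_norm_gauss_le hq hq1 hx
  refine Summable.of_nonneg_of_le (fun _ => norm_nonneg _) (fun k => ?_)
    ((summable_norm_phiCoeff hq1).mul_right M)
  rw [norm_mul]
  exact mul_le_mul_of_nonneg_left (hM _) (norm_nonneg _)

lemma phi_eq_tsum {q : ℝ} (hq0 : q ≠ 0) {x : ℂ} (hx : x ≠ 0) (n : ℤ) :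
    phi q x n = qpInf q (-1) * ∑' k : ℕ, phiCoeff q k * gauss q x (n - 2 * k) := by
  have hq : (q : ℂ) ≠ 0 := ofReal_ne_zero.2 hq0
  rw [phi, mul_assoc, mul_assoc, ← mul_assoc (x ^ n), ← tsum_mul_left]
  congr 1
  refine tsum_congr fun k => ?_
  have hk : ((2 * (k * (k - 1)) : ℕ) : ℤ) = 2 * (k * (k - 1)) := by cases k <;> simp
  have he : n * (n - 1) / 2 + (2 * (k * (k - 1)) + (-2 * n + 4) * k) =
      k + (n - 2 * k) * (n - 2 * k - 1) / 2 := by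
    have h1 := two_mul_triangle n
    have h2 := two_mul_triangle (n - 2 * k)
    refine mul_left_cancel₀ (two_ne_zero (α := ℤ)) ?_
    linear_combination h1 - h2
  have hx2 : x ^ (n - 2 * k) = x ^ n * (x ^ (-2 : ℤ)) ^ k := by
    rw [← zpow_natCast, ← zpow_mul, ← zpow_add₀ hx]
    ring_nf
  have hqe : (q : ℂ) ^ (n * (n - 1) / 2) * ((q : ℂ) ^ (2 * (k * (k - 1))) *
      ((q : ℂ) ^ (-2 * n + 4)) ^ k) =
      (q : ℂ) ^ k * (q : ℂ) ^ ((n - 2 * k) * (n - 2 * k - 1) / 2) := by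
    rw [← zpow_natCast (q : ℂ) (2 * (k * (k - 1))), hk, ← zpow_natCast ((q : ℂ) ^ (-2 * n + 4)),
      ← zpow_mul, ← zpow_add₀ hq, ← zpow_add₀ hq, he, zpow_add₀ hq, zpow_natCast]
  rw [phiCoeff, gauss, hx2, neg_mul, neg_pow, neg_pow (q : ℂ), mul_pow, div_eq_mul_inv]
  linear_combination
    (x ^ n * (-1) ^ k * (x ^ (-2 : ℤ)) ^ k * (qp ((q : ℂ) ^ 2) ((q : ℂ) ^ 2) k)⁻¹) * hqe

lemma summable_norm_phiCoeff_pair {q w : ℂ} (hq : q ≠ 0) (hq1 : ‖q‖ < 1) (hw : w ≠ 0) :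
    Summable fun c : ℕ × ℕ =>
      ‖phiCoeff q c.1 * phiCoeff q c.2 * gauss (q ^ 2) w (c.2 - c.1)‖ := by
  obtain ⟨M, hM⟩ := exists_norm_gauss_le (pow_ne_zero 2 hq) (norm_sq_lt_one hq1) hw
  refine Summable.of_nonneg_of_le (fun _ => norm_nonneg _) (fun k => ?_)
    (((summable_norm_phiCoeff hq1).mul_norm (summable_norm_phiCoeff hq1)).mul_right M)
  rw [norm_mul]
  exact mul_le_mul_of_nonneg_left (hM _) (norm_nonneg _)

/-- The bilateral sum of products factors into a double sum and a theta series. -/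
lemma hasSum_phi_mul_phi {q : ℝ} (hq0 : 0 < q) (hq1 : q < 1) {x y : ℂ} (hx : x ≠ 0) (hy : y ≠ 0) :
    HasSum (fun n : ℤ => phi q x n * phi q y n)
      (qpInf q (-1) ^ 2 * ((∑' c : ℕ × ℕ, phiCoeff q c.1 * phiCoeff q c.2 *
        gauss ((q : ℂ) ^ 2) (q * (x / y)) (c.2 - c.1)) *
          ∑' l : ℤ, gauss ((q : ℂ) ^ 2) (x * y) l)) := by
  have hq : (q : ℂ) ≠ 0 := ofReal_ne_zero.2 hq0.ne'
  have hqn : ‖(q : ℂ)‖ < 1 := by rwa [norm_real, Real.norm_of_nonneg hq0.le]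
  have hpair := summable_norm_phiCoeff_pair (w := q * (x / y)) hq hqn
    (mul_ne_zero hq (div_ne_zero hx hy))
  have hgauss := summable_norm_gauss (pow_ne_zero 2 hq) (norm_sq_lt_one hqn) (mul_ne_zero hx hy)
  have hG := (summable_mul_of_summable_norm hpair hgauss).hasSum
  rw [← tsum_mul_tsum_of_summable_norm hpair hgauss, ← pairShear.hasSum_iff] at hG
  refine (HasSum.prod_fiberwise (hG.mul_left (qpInf q (-1) ^ 2)) fun n => ?_)
  have hxn := summable_norm_phiCoeff_mul_gauss hq hqn hx n
  have hyn := summable_norm_phiCoeff_mul_gauss hq hqn hy n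
  rw [phi_eq_tsum hq0.ne' hx, phi_eq_tsum hq0.ne' hy, mul_mul_mul_comm, ← sq,
    tsum_mul_tsum_of_summable_norm hxn hyn]
  refine HasSum.mul_left _ ?_
  convert! (summable_mul_of_summable_norm hxn hyn).hasSum using 2 with c
  obtain ⟨a, b⟩ := c
  have h := gauss_add_mul_gauss_sub hq hx hy (n - a - b) (b - a)
  have h1 : n - a - b + (b - a) = n - 2 * a := by ring
  have h2 : n - a - b - (b - a) = n - 2 * b := by ring
  rw [h1, h2] at h
  simp only [pairShear, Function.comp, Equiv.coe_fn_mk]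
  linear_combination (-(phiCoeff q a * phiCoeff q b)) * h

lemma tsum_phiCoeff_pair {q : ℂ} (hq : q ≠ 0) (hq1 : ‖q‖ < 1) {s : ℤ} (hs : s ≤ 0) :
    ∑' c : ℕ × ℕ, phiCoeff q c.1 * phiCoeff q c.2 *
      gauss (q ^ 2) (q * (q ^ 2) ^ s) (c.2 - c.1) =
        if s = 0 then qpInf (q ^ 2) (q ^ 2) else 0 := by
  have hp := pow_ne_zero 2 hq
  have hp1 := norm_sq_lt_one hq1
  set p := q ^ 2 with hpq
  set w := q * p ^ s with hw
  have hw0 : w ≠ 0 := mul_ne_zero hq (zpow_ne_zero _ hp)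
  have hterm (a b : ℕ) : phiCoeff q a * phiCoeff q b * gauss p w (b - a) =
      phiCoeff q a * gauss p w (-a) * (gauss p (-1) b / qp p p b * (p ^ (1 + s - a)) ^ b) := by
    have h1 : p ^ (1 + s - a : ℤ) = q * (p ^ (-a : ℤ) * w) := by
      rw [sub_eq_add_neg, zpow_add₀ hp, zpow_add₀ hp, zpow_one, hw]
      nth_rw 1 [hpq]
      ring
    have h2 := gauss_mul_left p (-(p ^ (-a : ℤ) * w)) (-1) b
    rw [neg_mul_neg, mul_one] at h2
    rw [sub_eq_add_neg, gauss_add hp hw0, h2, h1, zpow_natCast, neg_pow, mul_pow, phiCoeff,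
      phiCoeff, neg_pow q b, div_eq_mul_inv]
    have h3 : ((-1 : ℂ) ^ b) * (-1) ^ b = 1 := by rw [← mul_pow]; simp
    linear_combination ((qp p p a)⁻¹ * (-q) ^ a * (qp p p b)⁻¹ * q ^ b * gauss p w (-a) *
      (p ^ (-a : ℤ) * w) ^ b * gauss p (-1) b) * h3
  have hsum : Summable fun c : ℕ × ℕ => phiCoeff q c.1 * phiCoeff q c.2 * gauss p w (c.2 - c.1) :=
    (summable_norm_phiCoeff_pair hq hq1 hw0).of_norm
  rw [hsum.tsum_prod]
  simp only [hterm, tsum_mul_left, ← qpInf_eq_tsum _ hp hp1]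
  rw [tsum_eq_single 0]
  · split_ifs with h
    · simp [h, phiCoeff, gauss, qp_zero]
    · rw [qpInf_zpow_eq_zero hp hp1 (by omega), mul_zero]
  · intro a ha
    rw [qpInf_zpow_eq_zero hp hp1 (by omega), mul_zero]

lemma hasSum_phi_mul_phi_of_le {q : ℝ} (hq0 : 0 < q) (hq1 : q < 1) {ω : ℝ} (hω : ω ≠ 0)
    {m n : ℤ} (hmn : m ≤ n) :
    HasSum (fun k : ℤ =>
        phi q ((ω : ℂ) * (q : ℂ) ^ (2 * m)) k * phi q ((ω : ℂ) * (q : ℂ) ^ (2 * n)) k)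
      ((if m = n then 1 else 0) * (ω : ℂ) ^ (-4 * n) * (q : ℂ) ^ (-2 * n * (2 * n - 1)) *
        (4 * (qpInf ((q : ℂ) ^ 2) ((q : ℂ) ^ 2) ^ 2 / qpInf ((q : ℂ) ^ 2) (q : ℂ) ^ 2) *
          theta ((q : ℂ) ^ 2) (-(ω : ℂ) ^ 2))) := by
  have hq : (q : ℂ) ≠ 0 := ofReal_ne_zero.2 hq0.ne'
  have hqn : ‖(q : ℂ)‖ < 1 := by rwa [norm_real, Real.norm_of_nonneg hq0.le]
  have hω' : (ω : ℂ) ≠ 0 := ofReal_ne_zero.2 hω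
  have h := hasSum_phi_mul_phi hq0 hq1 (mul_ne_zero hω' (zpow_ne_zero (2 * m) hq))
    (mul_ne_zero hω' (zpow_ne_zero (2 * n) hq))
  have hdiv : (ω : ℂ) * (q : ℂ) ^ (2 * m) / (ω * (q : ℂ) ^ (2 * n)) =
      ((q : ℂ) ^ 2) ^ (m - n) := by
    rw [mul_div_mul_left _ _ hω', ← zpow_sub₀ hq, ← mul_sub, zpow_mul]
    rfl
  rw [hdiv, tsum_phiCoeff_pair hq hqn (by omega)] at h
  convert! h using 1
  rcases eq_or_ne m n with rfl | hne
  · have hprod : (ω : ℂ) * (q : ℂ) ^ (2 * m) * (ω * (q : ℂ) ^ (2 * m)) =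
        ((q : ℂ) ^ 2) ^ (2 * m) * ω ^ 2 := by
      rw [zpow_mul (q : ℂ), zpow_ofNat, two_mul m, zpow_add₀ (pow_ne_zero 2 hq)]
      ring
    have hC := qpInf_neg_one_mul hqn
    have hne : qpInf ((q : ℂ) ^ 2) q ≠ 0 := right_ne_zero_of_mul (hC ▸ two_ne_zero)
    have hJ := jacobi_triple_product (pow_ne_zero 2 hq) (norm_sq_lt_one hqn)
      (neg_ne_zero.2 (pow_ne_zero 2 hω'))
    rw [neg_neg] at hJ
    have hg : (gauss ((q : ℂ) ^ 2) ((ω : ℂ) ^ 2) (2 * m))⁻¹ =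
        (ω : ℂ) ^ (-4 * m) * (q : ℂ) ^ (-2 * m * (2 * m - 1)) := by
      rw [gauss_sq, mul_inv, ← zpow_neg, ← zpow_neg, ← zpow_natCast (ω : ℂ), ← zpow_mul]
      congr 2 <;> push_cast <;> ring
    rw [hprod, tsum_gauss_zpow_mul (pow_ne_zero 2 hq) (pow_ne_zero 2 hω'), ← hJ, hg,
      eq_div_of_mul_eq hne hC]
    simp only [sub_self, if_true]
    field_simp
    ring
  · simp [hne, sub_eq_zero]

theorem stmt_7 (q : ℝ) (hq0 : 0 < q) (hq1 : q < 1) (ω : ℝ) (hω : ω ≠ 0) (m n : ℤ) :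
    HasSum (fun k : ℤ =>
        phi q ((ω : ℂ) * (q : ℂ) ^ (2 * m)) k * phi q ((ω : ℂ) * (q : ℂ) ^ (2 * n)) k)
      ((if m = n then 1 else 0) * (ω : ℂ) ^ (-4 * n) * (q : ℂ) ^ (-2 * n * (2 * n - 1)) *
        (4 * (qpInf ((q : ℂ) ^ 2) ((q : ℂ) ^ 2) ^ 2 / qpInf ((q : ℂ) ^ 2) (q : ℂ) ^ 2) *
          theta ((q : ℂ) ^ 2) (-(ω : ℂ) ^ 2))) ∧
    HasSum (fun k : ℤ =>
        phi q ((ω : ℂ) * (q : ℂ) ^ (2 * m)) k * phi q (-(ω : ℂ)⁻¹ * (q : ℂ) ^ (2 * n)) k)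
      0 := by
  refine ⟨?_, ?_⟩
  · rcases le_or_gt m n with hmn | hmn
    · exact hasSum_phi_mul_phi_of_le hq0 hq1 hω hmn
    · have h := hasSum_phi_mul_phi_of_le hq0 hq1 hω hmn.le
      simp only [if_neg hmn.ne, zero_mul] at h
      simp only [if_neg hmn.ne', zero_mul]
      simpa only [mul_comm] using h
  · have hq : (q : ℂ) ≠ 0 := ofReal_ne_zero.2 hq0.ne'
    have hqn : ‖(q : ℂ)‖ < 1 := by rwa [norm_real, Real.norm_of_nonneg hq0.le]
    have hω' : (ω : ℂ) ≠ 0 := ofReal_ne_zero.2 hω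
    have h := hasSum_phi_mul_phi hq0 hq1 (mul_ne_zero hω' (zpow_ne_zero (2 * m) hq))
      (mul_ne_zero (neg_ne_zero.2 (inv_ne_zero hω')) (zpow_ne_zero (2 * n) hq))
    have hprod : (ω : ℂ) * (q : ℂ) ^ (2 * m) * (-(ω : ℂ)⁻¹ * (q : ℂ) ^ (2 * n)) =
        -((q : ℂ) ^ 2) ^ (m + n) := by
      rw [zpow_add₀ (pow_ne_zero 2 hq), zpow_mul, zpow_mul, zpow_ofNat]
      field_simp
    rwa [hprod, tsum_gauss_neg_zpow (pow_ne_zero 2 hq) (norm_sq_lt_one hqn), mul_zero,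
      mul_zero] at h
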